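/- If x and y are elements of the first Weyl algebra A₁ over a field K of characteristic zero such that [y,x] = 1, then N(x, A₁) = N(y, A₁) = K⟨x,y⟩, the subalgebra of A₁ generated by x and y. -/

import Mathlib

def weylRel (K : Type*) [CommRing K] :
    FreeAlgebra K (Fin 2) → FreeAlgebra K (Fin 2) → Prop :=
  fun a b => a = FreeAlgebra.ι K 1 * FreeAlgebra.ι K 0 ∧
    b = FreeAlgebra.ι K 0 * FreeAlgebra.ι K 1 + 1

/-- The first Weyl algebra `A₁ = K⟨X, Y | YX - XY = 1⟩` over `K`,
realized as the quotient of the free algebra on two generators `X, Y`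
by the relation `Y * X = X * Y + 1`. -/
abbrev WeylAlgebra (K : Type*) [CommRing K] := RingQuot (weylRel K)


namespace WeylAux
open Polynomial

variable {K : Type*} [Field K]

noncomputable def gX (K : Type*) [Field K] : WeylAlgebra K := RingQuot.mkAlgHom K (weylRel K) (FreeAlgebra.ι K 0)
noncomputable def gY (K : Type*) [Field K] : WeylAlgebra K := RingQuot.mkAlgHom K (weylRel K) (FreeAlgebra.ι K 1)

theorem gYX : gY K * gX K = gX K * gY K + 1 := by
  have := RingQuot.mkAlgHom_rel K (s := weylRel K) (x := FreeAlgebra.ι K 1 * FreeAlgebra.ι K 0)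
    (y := FreeAlgebra.ι K 0 * FreeAlgebra.ι K 1 + 1) ⟨rfl, rfl⟩
  simpa [gX, gY] using this

noncomputable def dX (K : Type*) [Field K] : Derivation K K[X][X] K[X][X] :=
  (PolynomialModule.equivPolynomialSelf (R := K[X])).toLinearMap.compDer (Polynomial.derivative' (R := K)).mapCoeffs

theorem coeff_dX (p : K[X][X]) (i : ℕ) : (dX K p).coeff i = derivative (p.coeff i) := rfl

theorem dX_pow_mul (j : ℕ) (p : K[X][X]) : dX K (X ^ j * p) = X ^ j * dX K p := by
  ext1 i
  rw [coeff_dX, coeff_X_pow_mul', coeff_X_pow_mul']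
  split_ifs <;> simp [coeff_dX]

noncomputable def opL (K : Type*) [Field K] : Module.End K K[X][X] :=
  LinearMap.mulLeft K (X : K[X][X]) + (dX K : K[X][X] →ₗ[K] K[X][X])

theorem opL_apply (q : K[X][X]) : opL K q = X * q + dX K q := rfl

noncomputable def rho (K : Type*) [Field K] : WeylAlgebra K →ₐ[K] Module.End K K[X][X] :=
  RingQuot.liftAlgHom K ⟨FreeAlgebra.lift K ![LinearMap.mulLeft K (C X : K[X][X]), opL K], by
    rintro _ _ ⟨rfl, rfl⟩
    refine LinearMap.ext fun q => ?_
    simp [opL_apply, Derivation.leibniz]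
    have : dX K (C X : K[X][X]) = 1 := by
      ext1 i
      rw [coeff_dX, coeff_C, coeff_one]; split_ifs <;> simp
    rw [this]; ring⟩

theorem rho_gX : rho K (gX K) = LinearMap.mulLeft K (C X : K[X][X]) := by
  simp [rho, gX]
theorem rho_gY : rho K (gY K) = opL K := by
  simp [rho, gY]

noncomputable def Phi (p : K[X][X]) : WeylAlgebra K :=
  p.eval₂ (aeval (gX K) : K[X] →ₐ[K] WeylAlgebra K).toRingHom (gY K)

theorem Phi_add (p q : K[X][X]) : Phi (p + q) = Phi p + Phi q := eval₂_add ..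
theorem Phi_monomial (j : ℕ) (c : K[X]) : Phi (monomial j c) = aeval (gX K) c * gY K ^ j := 
  by simp [Phi]

theorem comm_aeval {A : Type*} [Ring A] [Algebra K A] {x y : A} (hyx : y * x = x * y + 1) (c : K[X]) :
    y * aeval x c = aeval x c * y + aeval x (derivative c) := by
  induction c using Polynomial.induction_on' with
  | add p q hp hq => simp only [map_add, mul_add, add_mul, hp, hq]; abel
  | monomial n a =>
    rw [← C_mul_X_pow_eq_monomial]
    have h : ∀ n : ℕ, y * x ^ n = x ^ n * y + n * x ^ (n-1) := by
      intro n
      induction n with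
      | zero => simp
      | succ n ih =>
        rw [pow_succ, ← mul_assoc, ih, add_mul, mul_assoc, hyx]
        rcases n with _ | n
        · simp
        · simp only [Nat.add_sub_cancel, pow_succ, Nat.cast_add, Nat.cast_one]
          noncomm_ring
    simp only [map_mul, aeval_C, map_pow, aeval_X, derivative_C_mul, derivative_X_pow, map_natCast]
    rw [← mul_assoc, ← Algebra.commutes, mul_assoc, h, mul_add, mul_assoc]

theorem gY_aeval (c : K[X]) : gY K * aeval (gX K) c = aeval (gX K) c * gY K + aeval (gX K) (derivative c) :=
  comm_aeval gYX c

theorem Phi_CX (q : K[X][X]) : Phi (C X * q) = gX K * Phi q := by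
  induction q using Polynomial.induction_on' with
  | add p q hp hq => rw [mul_add, Phi_add, Phi_add, hp, hq, mul_add]
  | monomial n a => rw [C_mul_monomial, Phi_monomial, Phi_monomial, map_mul, aeval_X, mul_assoc]

theorem Phi_L (q : K[X][X]) : Phi (opL K q) = gY K * Phi q := by
  induction q using Polynomial.induction_on' with
  | add p q hp hq => rw [map_add, Phi_add, Phi_add, hp, hq, mul_add]
  | monomial n a =>
    have : opL K (monomial n a) = monomial (n+1) a + monomial n (derivative a) := by
      rw [opL_apply, X_mul_monomial]
      congr 1
      ext1 i
      rw [coeff_dX, coeff_monomial, coeff_monomial]; split_ifs <;> simp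
    rw [this, Phi_add, Phi_monomial, Phi_monomial, Phi_monomial, ← mul_assoc, gY_aeval, pow_succ', add_mul, mul_assoc]

theorem Phi_smul (c : K) (q : K[X][X]) : Phi (c • q) = c • Phi q := by
  induction q using Polynomial.induction_on' with
  | add p q hp hq => rw [smul_add, Phi_add, Phi_add, hp, hq, smul_add]
  | monomial n a => rw [smul_monomial, Phi_monomial, Phi_monomial, map_smul, smul_mul_assoc]

theorem Phi_rho (a : WeylAlgebra K) (q : K[X][X]) : Phi (rho K a q) = a * Phi q := by
  obtain ⟨z, rfl⟩ := RingQuot.mkAlgHom_surjective K (weylRel K) a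
  induction z using FreeAlgebra.induction generalizing q with
  | grade0 r =>
    rw [AlgHom.commutes, AlgHom.commutes, Module.algebraMap_end_apply, Phi_smul, Algebra.smul_def]
  | grade1 i =>
    fin_cases i
    · exact (congrArg (fun f => Phi (f q)) rho_gX).trans (Phi_CX q)
    · exact (congrArg (fun f => Phi (f q)) rho_gY).trans (Phi_L q)
  | mul a b ha hb =>
    rw [map_mul, map_mul, Module.End.mul_apply, ha, hb, mul_assoc]
  | add a b ha hb =>
    rw [map_add, map_add, LinearMap.add_apply, Phi_add, ha, hb, add_mul]

/-- full symbol -/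
noncomputable def sg (a : WeylAlgebra K) : K[X][X] := rho K a 1

theorem Phi_one : Phi (1 : K[X][X]) = 1 := by simp [Phi]

theorem Phi_sg (a : WeylAlgebra K) : Phi (sg a) = a := by
  rw [sg, Phi_rho, Phi_one, mul_one]

theorem sg_mul (a b : WeylAlgebra K) : sg (a * b) = rho K a (sg b) := by
  simp [sg]
theorem sg_add (a b : WeylAlgebra K) : sg (a + b) = sg a + sg b := by
  simp [sg]
theorem sg_sub (a b : WeylAlgebra K) : sg (a - b) = sg a - sg b := by
  simp [sg]
theorem sg_smul (c : K) (b : WeylAlgebra K) : sg (c • b) = c • sg b := by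
  simp [sg]
theorem sg_one : sg (1 : WeylAlgebra K) = 1 := by
  simp [sg]
theorem sg_zero : sg (0 : WeylAlgebra K) = 0 := by
  simp [sg]
theorem sg_inj {a b : WeylAlgebra K} (h : sg a = sg b) : a = b := by
  rw [← Phi_sg a, h, Phi_sg]

theorem rho_aeval (c : K[X]) (q : K[X][X]) : rho K (aeval (gX K) c) q = C c * q := by
  rw [← aeval_algHom_apply, rho_gX]
  induction c using Polynomial.induction_on' with
  | add p q hp hq => rw [map_add, LinearMap.add_apply, hp, hq, C_add, add_mul]
  | monomial n a =>
    rw [aeval_monomial, ← C_mul_X_pow_eq_monomial, LinearMap.pow_mulLeft]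
    simp [Algebra.smul_def, mul_assoc]

theorem rho_Phi_monomial (j : ℕ) (c : K[X]) (q : K[X][X]) :
    rho K (Phi (C c * X ^ j)) q = C c * (opL K ^ j) q := by
  rw [C_mul_X_pow_eq_monomial, Phi_monomial, map_mul, Module.End.mul_apply, rho_aeval, map_pow, rho_gY]

theorem natDegree_dX_le {q : K[X][X]} {l : ℕ} (h : q.natDegree ≤ l) : (dX K q).natDegree ≤ l := by
  rw [natDegree_le_iff_coeff_eq_zero] at *
  intro i hi
  rw [coeff_dX, h i hi, map_zero]

theorem dcoef {R : Type*} [CommRing R] {p q : R[X]} {m l i : ℕ} (hp : p.natDegree ≤ m) (hq : q.natDegree ≤ l)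
    (hi : i + 1 = m + l) : (derivative p * q).coeff i = m * p.coeff m * q.coeff l := by
  rcases m with _ | m
  · rw [natDegree_eq_zero.mp (Nat.le_zero.mp hp) |>.choose_spec.symm]; simp
  · obtain rfl : i = m + l := by omega
    rw [coeff_mul_add_eq_of_natDegree_le _ hq, coeff_derivative]
    · push_cast; ring
    · exact (natDegree_derivative_le p).trans (by omega)

theorem dcoef0 {R : Type*} [CommRing R] {p q : R[X]} {m l i : ℕ} (hp : p.natDegree ≤ m) (hq : q.natDegree ≤ l)
    (hi : m + l ≤ i) : (derivative p * q).coeff i = 0 := by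
  rw [dcoef (m := m) (l := i + 1 - m) hp (hq.trans (by omega)) (by omega)]
  rw [coeff_eq_zero_of_natDegree_lt (p := q) (by omega), mul_zero]

theorem opL_pow {q : K[X][X]} {l : ℕ} (hq : q.natDegree ≤ l) (j : ℕ) : ∀ i, j + l ≤ i + 1 →
    ((opL K ^ j) q - (X ^ j * q + derivative (X ^ j : K[X][X]) * dX K q)).coeff i = 0 := by
  induction j with
  | zero => intro i _; simp
  | succ j ih =>
    intro i hi
    set R := (opL K ^ j) q - (X ^ j * q + derivative (X ^ j : K[X][X]) * dX K q) with hR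
    have e : (opL K ^ j) q = R + (X ^ j * q + derivative (X ^ j : K[X][X]) * dX K q) := by rw [hR]; ring
    have hd : dX K (derivative (X ^ j : K[X][X]) * dX K q) = derivative (X ^ j : K[X][X]) * dX K (dX K q) := by
      ext1 n
      rw [derivative_X_pow, coeff_dX, mul_assoc, mul_assoc, coeff_C_mul, coeff_C_mul, derivative_natCast_mul, ← coeff_dX, dX_pow_mul]
    have : (opL K ^ (j+1)) q - (X ^ (j+1) * q + derivative (X ^ (j+1) : K[X][X]) * dX K q)
      = X * R + dX K R + derivative (X ^ j : K[X][X]) * dX K (dX K q) := by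
      rw [pow_succ', Module.End.mul_apply, e, opL_apply, map_add, map_add, dX_pow_mul, hd,
        pow_succ', derivative_mul, derivative_X]
      ring
    rw [this, coeff_add, coeff_add, coeff_dX, ih i (by omega),
      dcoef0 (natDegree_X_pow_le j) (natDegree_dX_le (natDegree_dX_le hq)) (by omega)]
    rcases i with _ | i
    · simp
    · rw [coeff_X_mul, ih i (by omega)]; simp

theorem rho_coeff {p q : K[X][X]} {m l : ℕ} (hp : p.natDegree ≤ m) (hq : q.natDegree ≤ l) (i : ℕ) (hi : m + l ≤ i + 1) :
    (rho K (Phi p) q).coeff i = (p * q + derivative p * dX K q).coeff i := by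
  refine Polynomial.induction_with_natDegree_le
    (fun p => (rho K (Phi p) q).coeff i = (p * q + derivative p * dX K q).coeff i) m ?_ ?_ ?_ p hp
  · simp [Phi]
  · intro n r hr hn
    have := opL_pow hq n i (by omega)
    rw [coeff_sub, sub_eq_zero] at this
    rw [rho_Phi_monomial, coeff_C_mul, this, ← coeff_C_mul, derivative_C_mul]
    congr 1; ring
  · intro f g _ _ hf hg
    rw [Phi_add, map_add, LinearMap.add_apply, coeff_add, hf, hg, ← coeff_add]
    congr 1; rw [derivative_add]; ring

theorem sg_mul_coeff {a b : WeylAlgebra K} {m l : ℕ} (hp : (sg a).natDegree ≤ m) (hq : (sg b).natDegree ≤ l) (i : ℕ) (hi : m + l ≤ i + 1) :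
    (sg (a * b)).coeff i = (sg a * sg b + derivative (sg a) * dX K (sg b)).coeff i := by
  rw [← rho_coeff hp hq i hi, Phi_sg, sg_mul]

/-- `a` has order at most `m` with symbol `s` in degree `m`. -/
def H (a : WeylAlgebra K) (m : ℕ) (s : K[X]) : Prop := (sg a).natDegree ≤ m ∧ (sg a).coeff m = s

theorem H.mul {a b : WeylAlgebra K} {m l : ℕ} {s t : K[X]} (ha : H a m s) (hb : H b l t) :
    H (a * b) (m + l) (s * t) := by
  constructor
  · rw [natDegree_le_iff_coeff_eq_zero]
    intro i hi
    rw [sg_mul_coeff ha.1 hb.1 i (by omega), coeff_add,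
      dcoef0 ha.1 (natDegree_dX_le hb.1) (by omega), add_zero,
      coeff_eq_zero_of_natDegree_lt]
    exact (natDegree_mul_le_of_le ha.1 hb.1).trans_lt hi
  · rw [sg_mul_coeff ha.1 hb.1 _ (by omega), coeff_add,
      dcoef0 ha.1 (natDegree_dX_le hb.1) (by omega), add_zero,
      coeff_mul_add_eq_of_natDegree_le ha.1 hb.1, ha.2, hb.2]

theorem H.comm {a b : WeylAlgebra K} {m l i : ℕ} {s t : K[X]} (ha : H a m s) (hb : H b l t) (hi : i + 1 = m + l) :
    H (a * b - b * a) i (m * s * derivative t - l * t * derivative s) := by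
  constructor
  · rw [natDegree_le_iff_coeff_eq_zero]
    intro j hj
    rw [sg_sub, coeff_sub, sg_mul_coeff ha.1 hb.1 _ (by omega), sg_mul_coeff hb.1 ha.1 _ (by omega),
      coeff_add, coeff_add,
      dcoef0 ha.1 (natDegree_dX_le hb.1) (by omega), dcoef0 hb.1 (natDegree_dX_le ha.1) (by omega),
      mul_comm]
    simp
  · rw [sg_sub, coeff_sub, sg_mul_coeff ha.1 hb.1 _ (by omega), sg_mul_coeff hb.1 ha.1 _ (by omega),
      coeff_add, coeff_add,
      dcoef ha.1 (natDegree_dX_le hb.1) (by omega), dcoef hb.1 (natDegree_dX_le ha.1) (by omega),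
      coeff_dX, coeff_dX, mul_comm (sg b), ha.2, hb.2]
    ring

theorem H.add {a b : WeylAlgebra K} {m : ℕ} {s t : K[X]} (ha : H a m s) (hb : H b m t) :
    H (a + b) m (s + t) := by
  refine ⟨?_, by rw [sg_add, coeff_add, ha.2, hb.2]⟩
  rw [sg_add]; exact natDegree_add_le_of_degree_le ha.1 hb.1

theorem H.smul {a : WeylAlgebra K} {m : ℕ} {s : K[X]} (c : K) (ha : H a m s) :
    H (c • a) m (c • s) := by
  refine ⟨?_, by rw [sg_smul, coeff_smul, ha.2]⟩
  rw [sg_smul]; exact (natDegree_smul_le _ _).trans ha.1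

theorem H.one : H (1 : WeylAlgebra K) 0 1 := by
  simp [H, sg_one]

theorem H.pow {a : WeylAlgebra K} {m : ℕ} {s : K[X]} (ha : H a m s) (n : ℕ) : H (a ^ n) (n * m) (s ^ n) := by
  induction n with
  | zero => simpa using H.one
  | succ n ih =>
    rw [pow_succ, pow_succ, add_mul, one_mul]
    exact ih.mul ha

theorem H.uniq {a : WeylAlgebra K} {m : ℕ} {s t : K[X]} (ha : H a m s) (hb : H a m t) : s = t :=
  ha.2.symm.trans hb.2

/-- order -/
noncomputable def v (a : WeylAlgebra K) : ℕ := (sg a).natDegree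

theorem H.v_le {a : WeylAlgebra K} {m : ℕ} {s : K[X]} (ha : H a m s) : v a ≤ m := ha.1

theorem H.v_eq {a : WeylAlgebra K} {m : ℕ} {s : K[X]} (ha : H a m s) (hs : s ≠ 0) : v a = m :=
  natDegree_eq_of_le_of_coeff_ne_zero ha.1 (by rw [ha.2]; exact hs)

theorem H.v_lt {a : WeylAlgebra K} {m : ℕ} (ha : H a m 0) (h0 : a ≠ 0) : v a < m := by
  refine lt_of_le_of_ne ha.1 fun h => ?_
  have := ha.2
  rw [← h, v, coeff_natDegree, leadingCoeff_eq_zero] at this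
  exact h0 (sg_inj (this.trans sg_zero.symm))

theorem exH (a : WeylAlgebra K) (h0 : a ≠ 0) : ∃ s, s ≠ 0 ∧ H a (v a) s := by
  refine ⟨_, ?_, le_rfl, rfl⟩
  rw [v, coeff_natDegree, Ne, leadingCoeff_eq_zero]
  exact fun this => h0 (sg_inj (this.trans sg_zero.symm))

theorem H.zero (m : ℕ) : H (0 : WeylAlgebra K) m 0 := by simp [H, sg_zero]

theorem v_zero_of {a : WeylAlgebra K} (h : v a = 0) : a = aeval (gX K) ((sg a).coeff 0) := by
  conv_lhs => rw [← Phi_sg a, eq_C_of_natDegree_eq_zero h, ← monomial_zero_left, Phi_monomial]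
  simp

theorem H_aeval (c : K[X]) : H (aeval (gX K) c) 0 c := by
  simp [H, sg, rho_aeval]

theorem wr_deg [CharZero K] {P Q : K[X]} (hP : P ≠ 0) (hQ : Q ≠ 0) (h : derivative P * Q = derivative Q * P) :
    P.natDegree = Q.natDegree := by
  by_cases h0 : P.natDegree + Q.natDegree = 0
  · omega
  obtain ⟨i, hi⟩ := Nat.exists_eq_succ_of_ne_zero h0
  have h1 := congrArg (fun p => p.coeff i) h
  rw [dcoef le_rfl le_rfl (by omega), dcoef le_rfl le_rfl (by omega)] at h1
  simp only [coeff_natDegree] at h1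
  have hp := leadingCoeff_ne_zero.mpr hP
  have hq := leadingCoeff_ne_zero.mpr hQ
  have : (P.natDegree : K) = Q.natDegree := by
    apply mul_right_cancel₀ (mul_ne_zero hp hq)
    linear_combination h1
  exact_mod_cast this

theorem wr [CharZero K] {P Q : K[X]} (hQ : Q ≠ 0) (h : derivative P * Q = derivative Q * P) :
    ∃ c : K, P = c • Q := by
  by_cases hP : P = 0
  · exact ⟨0, by simp [hP]⟩
  have hd := wr_deg hP hQ h
  refine ⟨P.leadingCoeff / Q.leadingCoeff, ?_⟩
  set c := P.leadingCoeff / Q.leadingCoeff with hc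
  by_contra hne
  have hR : P - c • Q ≠ 0 := sub_ne_zero.mpr hne
  have h2 := wr_deg hR hQ (by
    rw [smul_eq_C_mul, derivative_sub, derivative_C_mul]
    linear_combination h)
  have h3 : (P - c • Q).coeff Q.natDegree = 0 := by
    rw [coeff_sub, coeff_smul, ← hd, coeff_natDegree, hd, coeff_natDegree, hc, smul_eq_mul,
      div_mul_cancel₀ _ (leadingCoeff_ne_zero.mpr hQ), sub_self]
  rw [← h2, coeff_natDegree] at h3
  exact hR (leadingCoeff_eq_zero.mp h3)

theorem exists_antideriv [CharZero K] (p : K[X]) : ∃ q : K[X], derivative q = p := by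
  induction p using Polynomial.induction_on' with
  | add p q hp hq =>
    obtain ⟨a, rfl⟩ := hp
    obtain ⟨b, rfl⟩ := hq
    exact ⟨a + b, derivative_add⟩
  | monomial n a =>
    refine ⟨monomial (n+1) (a / (n+1)), ?_⟩
    have : (n : K) + 1 ≠ 0 := by exact_mod_cast Nat.succ_ne_zero n
    rw [derivative_monomial]
    push_cast
    rw [div_mul_cancel₀ _ this]

theorem H.lift {a : WeylAlgebra K} {N : ℕ} (h : v a < N) : H a N 0 :=
  ⟨le_of_lt h, coeff_eq_zero_of_natDegree_lt h⟩

theorem H.ne_zero {a : WeylAlgebra K} {m : ℕ} {s : K[X]} (ha : H a m s) (hs : s ≠ 0) : a ≠ 0 := by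
  rintro rfl
  exact hs (ha.uniq (H.zero m))

theorem ns (c : K) (a : WeylAlgebra K) : (-c) • a = -(c • a) := neg_smul c a

/-- inner derivation by y -/
def D {A : Type*} [Ring A] (y f : A) : A := y * f - f * y

section
variable {A : Type*} [Ring A]
theorem D_mul (y f g : A) : D y (f * g) = D y f * g + f * D y g := by
  simp only [D]; noncomm_ring
theorem D_add (y f g : A) : D y (f + g) = D y f + D y g := by
  simp only [D]; noncomm_ring
theorem D_sub (y f g : A) : D y (f - g) = D y f - D y g := by
  simp only [D]; noncomm_ring
theorem D_smul [Algebra K A] (c : K) (y f : A) : D y (c • f) = c • D y f := by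
  simp only [D, mul_smul_comm, smul_mul_assoc, smul_sub]
theorem D_one {y : A} : D y 1 = 0 := by simp [D]
theorem D_zero {y : A} : D y 0 = 0 := by simp [D]
theorem D_aeval [Algebra K A] {x y : A} (hxy : y * x - x * y = 1) (q : K[X]) :
    D y (aeval x q) = aeval x (derivative q) := by
  rw [D, comm_aeval (by rw [← hxy]; abel)]; abel
theorem D_cent {x y : A} (hxy : y * x - x * y = 1) {f : A} (hf : f * x = x * f) :
    D y f * x = x * D y f := by
  have h1 : y * x = x * y + 1 := by rw [← hxy]; abel
  simp only [D, sub_mul, mul_sub]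
  rw [mul_assoc y, hf, ← mul_assoc, h1, mul_assoc f, h1]
  simp only [add_mul, mul_add, mul_assoc, mul_one, one_mul]
  rw [← mul_assoc f x, hf, mul_assoc]; abel
end

theorem D_pow {y f : WeylAlgebra K} {m d : ℕ} {s u : K[X]} (hf : H f m s) (hd : H (D y f) d u) (k : ℕ) :
    H (D y (f ^ (k + 1))) (k * m + d) ((k + 1 : ℕ) * s ^ k * u) := by
  induction k with
  | zero => simpa using hd
  | succ k ih =>
    rw [pow_succ f (k+1), D_mul]
    have h1 := ih.mul hf
    have h2 := (hf.pow (k+1)).mul hd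
    have e : k * m + d + m = (k + 1) * m + d := by ring
    rw [e] at h1
    convert h1.add h2 using 1
    push_cast; ring

section
variable [CharZero K] {x y : WeylAlgebra K}

theorem symb_eq {f g : WeylAlgebra K} {m n : ℕ} {s t : K[X]} (hf : H f m s) (hg : H g n t)
    (hc : f * g = g * f) : (m : K[X]) * s * derivative t = n * t * derivative s := by
  by_cases h0 : m + n = 0
  · obtain ⟨rfl, rfl⟩ : m = 0 ∧ n = 0 := by omega
    simp
  obtain ⟨i, hi⟩ := Nat.exists_eq_succ_of_ne_zero h0
  have := hf.comm hg hi.symm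
  rw [hc, sub_self] at this
  exact sub_eq_zero.mp (this.uniq (H.zero _))

theorem derpow (s : K[X]) (n : ℕ) : derivative (s ^ n) * s = n * s ^ n * derivative s := by
  rcases n with _ | n
  · simp
  · rw [derivative_pow]; simp; ring

theorem lead {f : WeylAlgebra K} {n : ℕ} {t : K[X]} (hx : H x n t) (ht : t ≠ 0) (hf0 : f ≠ 0)
    (hf : f * x = x * f) : ∃ (c : K) (g : WeylAlgebra K), c ≠ 0 ∧ f ^ n = c • x ^ (v f) + g ∧
      H g (n * v f) 0 ∧ g * x = x * g := by
  obtain ⟨s, hs, hfs⟩ := exH f hf0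
  have h1 := symb_eq hfs hx hf
  obtain ⟨c, hc⟩ := wr (P := s ^ n) (Q := t ^ (v f)) (pow_ne_zero _ ht) (by
    apply mul_right_cancel₀ (mul_ne_zero hs ht)
    have e1 := derpow s n
    have e2 := derpow t (v f)
    linear_combination (t ^ v f * t) * e1 - (s ^ n * s) * e2 - s ^ n * t ^ v f * h1)
  refine ⟨c, f ^ n - c • x ^ (v f), ?_, by abel, ?_, ?_⟩
  · rintro rfl
    rw [zero_smul] at hc
    exact pow_ne_zero _ hs hc
  · have h2 := (hx.pow (v f)).smul (-c)
    rw [mul_comm] at h2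
    have := (hfs.pow n).add h2
    rw [hc, ← add_smul, add_neg_cancel, zero_smul, ns, ← sub_eq_add_neg] at this
    exact this
  · have hc1 : Commute (f ^ n) x := (show Commute f x from hf).pow_left n
    have hc2 : Commute (c • x ^ (v f)) x := ((Commute.refl x).pow_left _).smul_left c
    exact (hc1.sub_left hc2)

theorem Dx_pow (hxy : y * x - x * y = 1) {n : ℕ} {t : K[X]} (hx : H x n t) (k : ℕ) :
    H (D y (x ^ (k + 1))) (k * n) ((k + 1 : ℕ) * t ^ k) := by
  have : H (D y x) 0 1 := by rw [D, hxy]; exact H.one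
  simpa using D_pow hx this k


theorem claimA (hxy : y * x - x * y = 1) {n : ℕ} {t : K[X]} (hx : H x n t) (ht : t ≠ 0) (hn : 0 < n)
    {f : WeylAlgebra K} (hf : f * x = x * f) (hD : D y f ≠ 0) : v (D y f) + n ≤ v f := by
  let P : ℕ → Prop := fun k => ∀ f : WeylAlgebra K, f * x = x * f → D y f ≠ 0 → v (D y f) + n ≤ v f + k
  have start : P (v y + n) := by
    intro f _ _
    have hy : H y (v y) _ := ⟨le_rfl, rfl⟩
    have hf : H f (v f) _ := ⟨le_rfl, rfl⟩
    have h2 := hf.mul hy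
    rw [add_comm] at h2
    have := (hy.mul hf).add (h2.smul (-1))
    rw [ns, one_smul, ← sub_eq_add_neg] at this
    have := this.v_le
    unfold D
    omega
  have step : ∀ k, P (k + 1) → P k := by
    intro k hk f hf hD
    by_contra hcon
    have hd := hk f hf hD
    have hd' : v (D y f) + n = v f + k + 1 := by omega
    have hf0 : f ≠ 0 := by rintro rfl; exact hD D_zero
    obtain ⟨s, hs, hfs⟩ := exH f hf0
    obtain ⟨u, hu, hDu⟩ := exH _ hD
    obtain ⟨c, g, hc, hfg, hg, hgx⟩ := lead hx ht hf0 hf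
    obtain ⟨n, rfl⟩ := Nat.exists_eq_succ_of_ne_zero hn.ne'
    have h1 := D_pow hfs hDu n
    have hN : n * v f + v (D y f) + (n + 1) = (n + 1) * v f + k + 1 := by linarith
    set N := n * v f + v (D y f)
    have hne : ((n + 1 : ℕ) : K[X]) * s ^ n * u ≠ 0 :=
      mul_ne_zero (mul_ne_zero (by exact_mod_cast Nat.succ_ne_zero n) (pow_ne_zero _ hs)) hu
    have h2 : H (D y (x ^ v f)) N 0 := by
      rcases hm : v f with _ | m
      · rw [pow_zero, D_one]; exact H.zero _
      · apply H.lift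
        refine (Dx_pow hxy hx m).v_le.trans_lt ?_
        rw [hm] at hN
        simp only [Nat.succ_eq_add_one]
        nlinarith
    have h3 : H (D y g) N (((n + 1 : ℕ) : K[X]) * s ^ n * u) := by
      have e : D y g = D y (f ^ (n + 1)) + (-c) • D y (x ^ v f) := by
        have : g = f ^ (n + 1) + (-c) • (x ^ v f) := by
          rw [Nat.succ_eq_add_one] at hfg
          rw [hfg, ns]; abel
        rw [this, D_add, D_smul]
      rw [e]
      simpa using h1.add (h2.smul (-c))
    have h4 := h3.ne_zero hne
    have hg0 : g ≠ 0 := by rintro rfl; exact h4 D_zero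
    have h5 := hg.v_lt hg0
    have h6 := hk g hgx h4
    rw [h3.v_eq hne] at h6
    simp only [Nat.succ_eq_add_one] at *
    omega
  have all : ∀ k, P k → P 0 := by
    intro k
    induction k with
    | zero => exact id
    | succ k ih => exact fun h => ih (step k h)
  exact all _ start f hf hD

theorem scalar_of (s : K[X]) (h : derivative s = 0) : ∃ c, s = C c :=
  ⟨_, eq_C_of_derivative_eq_zero h⟩

theorem claimB (hxy : y * x - x * y = 1) {n : ℕ} {t : K[X]} (hx : H x n t) (ht : t ≠ 0) (hn : 0 < n)
    {g : WeylAlgebra K} (hg : g * x = x * g) (hD : D y g = 0) : ∃ c : K, g = algebraMap K _ c := by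
  by_cases hg0 : g = 0
  · exact ⟨0, by simp [hg0]⟩
  rcases hm : v g with _ | m
  · have hs : H g 0 ((sg g).coeff 0) := ⟨hm.le, rfl⟩
    have h1 := symb_eq hs hx hg
    have h2 : derivative ((sg g).coeff 0) = 0 := by
      have hn' : (n : K[X]) ≠ 0 := by exact_mod_cast hn.ne'
      have : (n : K[X]) * t ≠ 0 := mul_ne_zero hn' ht
      simp only [Nat.cast_zero, zero_mul] at h1
      exact (mul_eq_zero.mp h1.symm).resolve_left this
    obtain ⟨c, hc⟩ := scalar_of _ h2
    refine ⟨c, ?_⟩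
    rw [v_zero_of hm, hc, aeval_C]
  · exfalso
    obtain ⟨c, h, hc, hfg, hh, hhx⟩ := lead hx ht hg0 hg
    rw [hm] at hfg hh
    have hgn : D y (g ^ n) = 0 := by
      have : Commute y g := sub_eq_zero.mp hD
      exact sub_eq_zero.mpr (this.pow_right n)
    rw [hfg, D_add, D_smul] at hgn
    have h1 := (Dx_pow hxy hx m).smul (-c)
    have e : (-c) • D y (x ^ (m + 1)) = D y h := by
      rw [ns]; exact neg_eq_of_add_eq_zero_right hgn
    rw [e] at h1
    have hne : (-c) • (((m + 1 : ℕ) : K[X]) * t ^ m) ≠ 0 :=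
      smul_ne_zero (neg_ne_zero.mpr hc) (mul_ne_zero (by exact_mod_cast Nat.succ_ne_zero m) (pow_ne_zero _ ht))
    have h4 := h1.ne_zero hne
    have hg0 : h ≠ 0 := by rintro rfl; exact h4 D_zero
    have h5 := hh.v_lt hg0
    have h6 := claimA hxy hx ht hn hhx h4
    rw [h1.v_eq hne] at h6
    nlinarith

theorem claimC (hxy : y * x - x * y = 1) {n : ℕ} {t : K[X]} (hx : H x n t) (ht : t ≠ 0) (hn : 0 < n)
    (N : ℕ) : ∀ f : WeylAlgebra K, v f < N → f * x = x * f → ∃ p : K[X], f = aeval x p := by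
  induction N with
  | zero => intro f h; omega
  | succ N ih =>
    intro f hN hf
    obtain ⟨p, hp⟩ : ∃ p : K[X], D y f = aeval x p := by
      by_cases hD : D y f = 0
      · exact ⟨0, by simp [hD]⟩
      · have := claimA hxy hx ht hn hf hD
        exact ih _ (by omega) (D_cent hxy hf)
    obtain ⟨q, rfl⟩ := exists_antideriv p
    have hq : Commute (aeval x q) x := by
      have : Commute (aeval x q) (aeval x (X : K[X])) := by
        rw [Commute, SemiconjBy, ← map_mul, ← map_mul, mul_comm]
      simpa using this
    obtain ⟨c, hc⟩ := claimB hxy hx ht hn (g := f - aeval x q)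
      ((show Commute f x from hf).sub_left hq) (by
        rw [D_sub, hp, D_aeval hxy, sub_self])
    refine ⟨q + C c, ?_⟩
    rw [map_add, aeval_C, ← hc]; abel

theorem cent_eq (hxy : y * x - x * y = 1) {f : WeylAlgebra K} (hf : f * x = x * f) :
    ∃ p : K[X], f = aeval x p := by
  have h10 : (1 : WeylAlgebra K) ≠ 0 := H.one.ne_zero one_ne_zero
  have hx0 : x ≠ 0 := by
    rintro rfl
    simp at hxy
    exact h10 hxy.symm
  have hy0 : y ≠ 0 := by
    rintro rfl
    simp at hxy
    exact h10 hxy.symm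
  obtain ⟨t, ht, hx⟩ := exH x hx0
  rcases Nat.eq_zero_or_pos (v x) with hn | hn
  swap
  · exact claimC hxy hx ht hn _ f (Nat.lt_succ_self _) hf
  by_cases hf0 : f = 0
  · exact ⟨0, by simp [hf0]⟩
  rw [hn] at hx
  have hxt : x = aeval (gX K) t := by rw [v_zero_of hn, hx.2]
  have ht' : derivative t ≠ 0 := by
    intro h
    obtain ⟨c, hc⟩ := scalar_of _ h
    rw [hxt, hc, aeval_C, ← Algebra.commutes, sub_self] at hxy
    exact h10 hxy.symm
  obtain ⟨s, hs, hfs⟩ := exH f hf0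
  have hvf : v f = 0 := by
    have h1 := symb_eq hfs hx hf
    simp only [Nat.cast_zero, zero_mul] at h1
    have h2 := (mul_eq_zero.mp h1).resolve_right ht'
    exact_mod_cast (mul_eq_zero.mp h2).resolve_right hs
  have hfa := v_zero_of hvf
  obtain ⟨r, hr, hy⟩ := exH y hy0
  rcases hd : v y with _ | i
  · exfalso
    rw [hxt, v_zero_of hd, ← map_mul, ← map_mul, mul_comm, sub_self] at hxy
    exact h10 hxy.symm
  have h1 := hy.comm hx (i := i) (by omega)
  rw [hxy] at h1
  have hne : ((v y : ℕ) : K[X]) * r * derivative t ≠ 0 :=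
    mul_ne_zero (mul_ne_zero (by rw [hd]; exact_mod_cast Nat.succ_ne_zero i) hr) ht'
  simp only [Nat.cast_zero, zero_mul, sub_zero] at h1
  have hi : i = 0 := (h1.v_eq hne).symm.trans (H.one.v_eq one_ne_zero)
  subst hi
  have h2 := h1.uniq H.one
  have hu : IsUnit (derivative t) := IsUnit.of_mul_eq_one_right _ h2
  obtain ⟨b, hb, hbt⟩ := Polynomial.isUnit_iff.mp hu
  obtain ⟨a, ha⟩ := scalar_of (t - C b * X) (by rw [derivative_sub, derivative_C_mul, derivative_X, hbt]; simp)
  have hb0 : b ≠ 0 := hb.ne_zero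
  have hX : gX K = aeval x (C b⁻¹ * (X - C a) : K[X]) := by
    have : t = C b * X + C a := by rw [← ha]; ring
    rw [this] at hxt
    rw [hxt, map_mul, map_sub, aeval_C, aeval_C, aeval_X, map_add, map_mul, aeval_C, aeval_C, aeval_X,
      add_sub_cancel_right, ← mul_assoc, ← map_mul, inv_mul_cancel₀ hb0, map_one, one_mul]
  refine ⟨((sg f).coeff 0).comp (C b⁻¹ * (X - C a)), ?_⟩
  rw [aeval_comp, ← hX]
  exact hfa

end

theorem iter_mul {A : Type*} [Ring A] (x : A) (a b : A) (i j : ℕ)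
    (ha : (fun c => x * c - c * x)^[i] a = 0) (hb : (fun c => x * c - c * x)^[j] b = 0) :
    (fun c => x * c - c * x)^[i + j] (a * b) = 0 := by
  have h0 : ∀ k, (fun c => x * c - c * x)^[k] 0 = 0 := fun k =>
    Function.iterate_fixed (by simp) k
  have hadd : ∀ k a b, (fun c => x * c - c * x)^[k] (a + b) =
      (fun c => x * c - c * x)^[k] a + (fun c => x * c - c * x)^[k] b := by
    intro k
    induction k with
    | zero => intros; rfl
    | succ k ih =>
      intro a b
      rw [Function.iterate_succ_apply, Function.iterate_succ_apply, Function.iterate_succ_apply, ← ih]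
      congr 1; noncomm_ring
  induction i generalizing a b j with
  | zero =>
    have : a = 0 := ha
    rw [this, zero_mul, h0]
  | succ i ihi =>
    induction j generalizing b with
    | zero =>
      have : b = 0 := hb
      rw [this, mul_zero, h0]
    | succ j ihj =>
      rw [Function.iterate_succ_apply] at hb
      have h2 := ihj _ hb
      have h3 := ihi (x * a - a * x) b (j+1) (by rwa [Function.iterate_succ_apply] at ha)
        (by rwa [Function.iterate_succ_apply])
      rw [← add_assoc, Function.iterate_succ_apply]
      have e : x * (a * b) - a * b * x = (x * a - a * x) * b + a * (x * b - b * x) := by noncomm_ring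
      simp only [e]
      rw [hadd, h2, add_zero]
      rw [show i + 1 + j = i + (j + 1) by omega]
      exact h3

theorem half [CharZero K] {A : Type*} [Ring A] [Algebra K A] (x y : A) (hxy : y * x - x * y = 1)
    (cent_eq : ∀ f : A, f * x = x * f → ∃ p : K[X], f = aeval x p) :
    ({b : A | ∃ i : ℕ, (fun c => x * c - c * x)^[i + 1] b = 0}
      = (Algebra.adjoin K ({x, y} : Set (A)) : Set (A))) := by
  have hxm : x ∈ Algebra.adjoin K ({x, y} : Set (A)) := Algebra.subset_adjoin (by simp)
  have hym : y ∈ Algebra.adjoin K ({x, y} : Set (A)) := Algebra.subset_adjoin (by simp)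
  set ad : Module.End K (A) := LinearMap.mulLeft K x - LinearMap.mulRight K x with had
  have hfun : (fun c => x * c - c * x) = (ad : A → A) := by
    ext c; simp [had]
  have adap : ∀ c, ad c = x * c - c * x := fun c => by simp [had]
  have key : ∀ i b, (ad ^ i) b = 0 → b ∈ Algebra.adjoin K ({x, y} : Set (A)) := by
    have hy : ∀ i : ℕ, ad (y ^ (i + 1)) = (-((i : K) + 1)) • y ^ i := by
      intro i
      induction i with
      | zero => rw [adap]; simp [← hxy]
      | succ i ih =>
        have : ad (y ^ (i + 1 + 1)) = ad (y ^ (i + 1)) * y + y ^ (i + 1) * ad y := by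
          rw [pow_succ, adap, adap, adap]; noncomm_ring
        have h1 : ad y = (-1 : K) • (1 : A) := by rw [adap, ← hxy]; simp
        rw [this, ih, h1, smul_mul_assoc, ← pow_succ, mul_smul_comm, mul_one, ← add_smul]
        congr 1; push_cast; ring
    have hyy : ∀ i : ℕ, ∃ κ : K, κ ≠ 0 ∧ (ad ^ i) (y ^ i) = κ • (1 : A) := by
      intro i
      induction i with
      | zero => exact ⟨1, one_ne_zero, by simp⟩
      | succ i ih =>
        obtain ⟨κ, h0, h⟩ := ih
        refine ⟨(-((i : K) + 1)) * κ, mul_ne_zero (neg_ne_zero.mpr (by exact_mod_cast Nat.succ_ne_zero i)) h0, ?_⟩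
        rw [pow_succ, Module.End.mul_apply, hy, map_smul, h, smul_smul]
    have hcm : ∀ c : A, c * x = x * c → ∀ i z, (ad ^ i) (c * z) = c * (ad ^ i) z := by
      intro c hc i
      induction i with
      | zero => intro z; simp
      | succ i ih =>
        intro z
        rw [pow_succ, Module.End.mul_apply, Module.End.mul_apply, ← ih]
        congr 1
        rw [adap, adap, ← mul_assoc, ← hc]; noncomm_ring
    intro i
    induction i with
    | zero =>
      intro b hb
      have : b = 0 := by simpa using hb
      rw [this]; exact Subalgebra.zero_mem _
    | succ i ih =>
      intro b hb
      rw [pow_succ', Module.End.mul_apply, adap, sub_eq_zero] at hb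
      obtain ⟨p, hp⟩ := cent_eq _ hb.symm
      obtain ⟨κ, h0, h⟩ := hyy i
      have hcmem : (ad ^ i) b ∈ Algebra.adjoin K ({x, y} : Set (A)) := by
        rw [hp]
        exact Algebra.adjoin_mono (by simp) (aeval_mem_adjoin_singleton K x)
      have h1 := ih (b - κ⁻¹ • ((ad ^ i) b * y ^ i)) (by
        rw [map_sub, map_smul, hcm _ hb.symm, h, mul_smul_comm, smul_smul, inv_mul_cancel₀ h0, mul_one,
          one_smul, sub_self])
      have h2 := Subalgebra.add_mem _ h1 (Subalgebra.smul_mem _ (Subalgebra.mul_mem _ hcmem (Subalgebra.pow_mem _ hym i)) κ⁻¹)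
      rwa [sub_add_cancel] at h2
  ext b
  constructor
  · rintro ⟨i, hi⟩
    rw [hfun, ← Module.End.pow_apply] at hi
    exact key _ _ hi
  · intro hb
    have pad : ∀ (b : A) (i j : ℕ), (ad ^ i) b = 0 → (ad ^ (j + i)) b = 0 := by
      intro b i j h
      rw [pow_add, Module.End.mul_apply, h, map_zero]
    have : ∃ i, (ad ^ i) b = 0 := by
      induction hb using Algebra.adjoin_induction with
      | mem z hz =>
        rcases hz with rfl | hz
        · exact ⟨1, by simp [adap]⟩
        · obtain rfl : z = y := hz
          refine ⟨2, ?_⟩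
          have h1 : ad z = (-1 : K) • (1 : A) := by rw [adap, ← hxy]; simp
          rw [pow_succ, pow_one, Module.End.mul_apply, h1, adap]; simp
      | algebraMap r => exact ⟨1, by rw [pow_one, adap, Algebra.commutes, sub_self]⟩
      | add a b _ _ ha hb =>
        obtain ⟨i, hi⟩ := ha
        obtain ⟨j, hj⟩ := hb
        refine ⟨i + j, ?_⟩
        rw [map_add, pad b j i hj, add_comm i j, pad a i j hi, add_zero]
      | mul a b _ _ ha hb =>
        obtain ⟨i, hi⟩ := ha
        obtain ⟨j, hj⟩ := hb
        refine ⟨i + j, ?_⟩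
        rw [Module.End.pow_apply, ← hfun] at *
        exact iter_mul x a b i j hi hj
    obtain ⟨i, hi⟩ := this
    refine ⟨i, ?_⟩
    rw [hfun, ← Module.End.pow_apply, add_comm]
    exact pad b i 1 hi

theorem neg_pair {A : Type*} [Ring A] {x y : A} (hxy : y * x - x * y = 1) : -x * y - y * -x = 1 := by
  rw [← hxy]; noncomm_ring

end WeylAux

/-- **Proposition 2.6.** If `[y,x] = 1` for elements `x, y` of the Weyl algebra `A₁` over a
field `K` of characteristic zero, then `N(x, A₁) = N(y, A₁) = K⟨x,y⟩`, where
`N(a, A₁) = ⋃_{i ≥ 0} ker(ad(a)^{i+1})` is the set of elements of `A₁` on which the inner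
derivation `ad(a) = [a, ·]` acts nilpotently. -/
theorem nil_algebra_eq_adjoin (K : Type*) [Field K] [CharZero K]
    (x y : WeylAlgebra K) (hxy : y * x - x * y = 1) :
    ({b : WeylAlgebra K | ∃ i : ℕ, (fun c => x * c - c * x)^[i + 1] b = 0}
      = (Algebra.adjoin K ({x, y} : Set (WeylAlgebra K)) : Set (WeylAlgebra K)))
    ∧ ({b : WeylAlgebra K | ∃ i : ℕ, (fun c => y * c - c * y)^[i + 1] b = 0}
      = (Algebra.adjoin K ({x, y} : Set (WeylAlgebra K)) : Set (WeylAlgebra K))) := by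

  refine ⟨WeylAux.half x y hxy (fun f hf => WeylAux.cent_eq hxy hf), ?_⟩
  have h2 : -x * y - y * -x = 1 := WeylAux.neg_pair hxy
  rw [WeylAux.half y (-x) h2 (fun f hf => WeylAux.cent_eq h2 hf)]
  congr 1
  apply le_antisymm <;> refine Algebra.adjoin_le ?_ <;> rintro z (rfl | hz)
  · exact Algebra.subset_adjoin (by simp)
  · obtain rfl : z = -x := hz
    exact Subalgebra.neg_mem _ (Algebra.subset_adjoin (by simp))
  · rw [← neg_neg z]
    exact Subalgebra.neg_mem _ (Algebra.subset_adjoin (by simp))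
  · obtain rfl : z = y := hz
    exact Algebra.subset_adjoin (by simp)
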